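/- arXiv:1910.10924 — 5 statements merged into one kernel-verified Lean document; each statement's English description precedes it below -/
import Mathlib

section
/- Let X_1,…,X_n be elements of H and let Q be a Borel probability measure on H. Then the statistic T_n = ∫_H |φ_n(f) − φ(f; X̄_n, C_n)|² Q(df) admits the representation T_n = 1/n + (2/n²) Σ_{1≤j<k≤n} ∫_H cos⟨f, X_j − X_k⟩ Q(df) − (2/n) Σ_{j=1}^n ∫_H cos⟨f, X_j − X̄_n⟩ exp(−⟨C_n f, f⟩/2) Q(df) + ∫_H exp(−⟨C_n f, f⟩) Q(df). -/
open MeasureTheory Filter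
open scoped RealInnerProductSpace BigOperators

noncomputable section

variable {H : Type*} [NormedAddCommGroup H] [InnerProductSpace ℝ H]

/-- The empirical characteristic functional `φ_n` of the points `X 0, …, X (n-1)`. -/
def ecf (n : ℕ) (X : ℕ → H) (f : H) : ℂ :=
  (n : ℂ)⁻¹ * ∑ j ∈ Finset.range n, Complex.exp (Complex.I * (⟪f, X j⟫ : ℝ))

/-- The sample mean `X̄_n` of the points `X 0, …, X (n-1)`. -/
def smean (n : ℕ) (X : ℕ → H) : H :=
  (n : ℝ)⁻¹ • ∑ j ∈ Finset.range n, X j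

/-- The quadratic form `f ↦ ⟪C_n f, f⟫` of the sample covariance operator `C_n`
of the points `X 0, …, X (n-1)` (this is its defining property). -/
def scovQF (n : ℕ) (X : ℕ → H) (f : H) : ℝ :=
  (n : ℝ)⁻¹ * ∑ j ∈ Finset.range n, (⟪X j - smean n X, f⟫ : ℝ) ^ 2

/-- The Gaussian characteristic functional `φ(f; μ, C) = exp(i⟪μ,f⟫ - ⟪Cf,f⟫/2)`,
where `c f = ⟪C f, f⟫` is the quadratic form of the covariance operator `C`. -/
def gcf (μ : H) (c : H → ℝ) (f : H) : ℂ :=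
  Complex.exp (Complex.I * (⟪μ, f⟫ : ℝ) - (c f : ℂ) / 2)

lemma sq_sum_cos_add_sq_sum_sin (n : ℕ) (a : ℕ → ℝ) :
    (∑ j ∈ Finset.range n, Real.cos (a j)) ^ 2 + (∑ j ∈ Finset.range n, Real.sin (a j)) ^ 2
      = n + 2 * ∑ j ∈ Finset.range n, ∑ k ∈ Finset.range n,
          if j < k then Real.cos (a j - a k) else 0 := by
  induction n with
  | zero => simp
  | succ n ih =>
    have inner_sum (j : ℕ) (hj : j ∈ Finset.range n) :
        (∑ k ∈ Finset.range (n + 1), if j < k then Real.cos (a j - a k) else 0)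
          = (∑ k ∈ Finset.range n, if j < k then Real.cos (a j - a k) else 0)
            + (Real.cos (a j) * Real.cos (a n) + Real.sin (a j) * Real.sin (a n)) := by
      rw [Finset.sum_range_succ, if_pos (Finset.mem_range.1 hj), Real.cos_sub]
    have last_sum :
        (∑ k ∈ Finset.range (n + 1), if n < k then Real.cos (a n - a k) else 0) = 0 :=
      Finset.sum_eq_zero fun k hk => if_neg (by have := Finset.mem_range.1 hk; omega)
    rw [Finset.sum_range_succ (fun j => ∑ k ∈ Finset.range (n + 1), _), last_sum,
      Finset.sum_congr rfl inner_sum, Finset.sum_add_distrib, Finset.sum_add_distrib,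
      ← Finset.sum_mul, ← Finset.sum_mul, Finset.sum_range_succ, Finset.sum_range_succ]
    push_cast
    linear_combination ih + Real.sin_sq_add_cos_sq (a n)

lemma ecf_re (n : ℕ) (X : ℕ → H) (f : H) :
    (ecf n X f).re = (n : ℝ)⁻¹ * ∑ j ∈ Finset.range n, Real.cos ⟪f, X j⟫ := by
  rw [ecf, ← Complex.ofReal_natCast, ← Complex.ofReal_inv, Complex.re_ofReal_mul, Complex.re_sum]
  simp [Complex.exp_re]

lemma ecf_im (n : ℕ) (X : ℕ → H) (f : H) :
    (ecf n X f).im = (n : ℝ)⁻¹ * ∑ j ∈ Finset.range n, Real.sin ⟪f, X j⟫ := by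
  rw [ecf, ← Complex.ofReal_natCast, ← Complex.ofReal_inv, Complex.im_ofReal_mul, Complex.im_sum]
  simp [Complex.exp_im]

lemma gcf_re (μ : H) (c : H → ℝ) (f : H) :
    (gcf μ c f).re = Real.exp (-c f / 2) * Real.cos ⟪f, μ⟫ := by
  simp [gcf, Complex.exp_re, real_inner_comm, neg_div]

lemma gcf_im (μ : H) (c : H → ℝ) (f : H) :
    (gcf μ c f).im = Real.exp (-c f / 2) * Real.sin ⟪f, μ⟫ := by
  simp [gcf, Complex.exp_im, real_inner_comm, neg_div]

lemma norm_ecf_sub_gcf_sq (n : ℕ) (hn : 0 < n) (X : ℕ → H) (μ : H) (c : H → ℝ) (f : H) :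
    ‖ecf n X f - gcf μ c f‖ ^ 2
      = 1 / n
        + (2 / (n : ℝ) ^ 2) *
            ∑ j ∈ Finset.range n, ∑ k ∈ Finset.range n,
              (if j < k then Real.cos ⟪f, X j - X k⟫ else 0)
        - (2 / n) * ∑ j ∈ Finset.range n, Real.cos ⟪f, X j - μ⟫ * Real.exp (-c f / 2)
        + Real.exp (-c f) := by
  have hn' : (n : ℝ) ≠ 0 := by positivity
  have hexp : Real.exp (-c f) = Real.exp (-c f / 2) ^ 2 := by
    rw [← Real.exp_nat_mul]; congr 1; push_cast; ring
  have hsum := sq_sum_cos_add_sq_sum_sin n fun j => ⟪f, X j⟫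
  simp only [inner_sub_right]
  rw [← Finset.sum_mul, Complex.sq_norm, Complex.normSq_apply, Complex.sub_re, Complex.sub_im,
    ecf_re, ecf_im, gcf_re, gcf_im, hexp]
  simp only [Real.cos_sub ⟪f, X _⟫ ⟪f, μ⟫, Finset.sum_add_distrib, ← Finset.sum_mul]
  have htrig := Real.sin_sq_add_cos_sq ⟪f, μ⟫
  generalize Real.exp (-c f / 2) = e
  field_simp
  linear_combination hsum + n ^ 2 * e ^ 2 * htrig

lemma continuous_scovQF (n : ℕ) (X : ℕ → H) : Continuous (scovQF n X) := by
  unfold scovQF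
  fun_prop

lemma scovQF_nonneg (n : ℕ) (X : ℕ → H) (f : H) : 0 ≤ scovQF n X f := by
  unfold scovQF
  positivity

lemma integrable_of_continuous_of_abs_le_one {E : Type*} [TopologicalSpace E] [MeasurableSpace E]
    [BorelSpace E] {Q : Measure E} [IsFiniteMeasure Q] {g : E → ℝ} (hg : Continuous g)
    (hb : ∀ f, |g f| ≤ 1) :
    Integrable g Q :=
  Integrable.of_bound hg.measurable.aestronglyMeasurable 1 (.of_forall hb)

/-- the representation of the statistic
`T_n = ∫_H |φ_n(f) − φ(f; X̄_n, C_n)|² Q(df)`. -/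
theorem statement0 [MeasurableSpace H] [BorelSpace H]
    (Q : Measure H) [IsProbabilityMeasure Q] (n : ℕ) (hn : 0 < n) (X : ℕ → H) :
    (∫ f, ‖ecf n X f - gcf (smean n X) (scovQF n X) f‖ ^ 2 ∂Q)
      = 1 / n
        + (2 / (n : ℝ) ^ 2) *
            ∑ j ∈ Finset.range n, ∑ k ∈ Finset.range n,
              (if j < k then ∫ f, Real.cos ⟪f, X j - X k⟫ ∂Q else 0)
        - (2 / n) * ∑ j ∈ Finset.range n,
            (∫ f, Real.cos ⟪f, X j - smean n X⟫ * Real.exp (- scovQF n X f / 2) ∂Q)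
        + ∫ f, Real.exp (- scovQF n X f) ∂Q := by
  have hexp : Integrable (fun f => Real.exp (-scovQF n X f)) Q := by
    refine integrable_of_continuous_of_abs_le_one (continuous_scovQF n X).neg.rexp fun f => ?_
    rw [Real.abs_exp, Real.exp_le_one_iff]
    linarith [scovQF_nonneg n X f]
  have hpair (j k : ℕ) :
      Integrable (fun f => if j < k then Real.cos ⟪f, X j - X k⟫ else 0) Q := by
    split_ifs
    · exact integrable_of_continuous_of_abs_le_one (by fun_prop) fun f => Real.abs_cos_le_one _
    · exact integrable_zero _ _ _
  have hcross (j : ℕ) : Integrable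
      (fun f => Real.cos ⟪f, X j - smean n X⟫ * Real.exp (-scovQF n X f / 2)) Q := by
    have := continuous_scovQF n X
    refine integrable_of_continuous_of_abs_le_one (by fun_prop) fun f => ?_
    rw [abs_mul, Real.abs_exp]
    refine mul_le_one₀ (Real.abs_cos_le_one _) (Real.exp_nonneg _) ?_
    rw [Real.exp_le_one_iff]
    linarith [scovQF_nonneg n X f]
  have hpairs (j : ℕ) := integrable_finsetSum (Finset.range n) fun k _ => hpair j k
  have hpairs_sum := (integrable_finsetSum (Finset.range n) fun j _ => hpairs j).const_mul
    (2 / (n : ℝ) ^ 2)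
  have hcross_sum := (integrable_finsetSum (Finset.range n) fun j _ => hcross j).const_mul
    (2 / (n : ℝ))
  have hconst : Integrable (fun _ : H => 1 / (n : ℝ)) Q := integrable_const _
  simp only [norm_ecf_sub_gcf_sq n hn]
  rw [integral_add ?_ hexp,
    integral_sub (hconst.fun_add hpairs_sum) hcross_sum, integral_add hconst hpairs_sum,
    integral_const_mul, integral_const_mul, integral_finsetSum _ fun j _ => hpairs j,
    integral_finsetSum _ fun j _ => hcross j]
  simp only [integral_finsetSum _ fun k _ => hpair _ k, integral_const, probReal_univ, one_smul]
  · congr! 6 with j _ k _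
    split_ifs <;> simp
  · exact (hconst.fun_add hpairs_sum).sub hcross_sum

end
end

section
/- Let X_1,…,X_n be elements of H and let Q be a Borel probability measure on H that is symmetric, i.e., invariant under the map x ↦ −x. Then n·T_n = ∫_H V_n(f)² Q(df), where V_n(f) = n^{-1/2} Σ_{j=1}^n { cos⟨f, X_j − X̄_n⟩ + sin⟨f, X_j − X̄_n⟩ − exp(−½⟨C_n f, f⟩) }. -/
open MeasureTheory Filter
open scoped RealInnerProductSpace BigOperators

noncomputable section

variable {H : Type*} [NormedAddCommGroup H] [InnerProductSpace ℝ H]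

/-- The process `V_n`. -/
def Vn (n : ℕ) (X : ℕ → H) (f : H) : ℝ :=
  (Real.sqrt n)⁻¹ * ∑ j ∈ Finset.range n,
    (Real.cos ⟪f, X j - smean n X⟫ + Real.sin ⟪f, X j - smean n X⟫
      - Real.exp (- scovQF n X f / 2))

/-- The real part of the recentred difference of characteristic functionals. -/
def centredCos (n : ℕ) (X : ℕ → H) (f : H) : ℝ :=
  (n : ℝ)⁻¹ * ∑ j ∈ Finset.range n,
    (Real.cos ⟪f, X j - smean n X⟫ - Real.exp (- scovQF n X f / 2))

/-- The imaginary part of the recentred difference of characteristic functionals. -/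
def centredSin (n : ℕ) (X : ℕ → H) (f : H) : ℝ :=
  (n : ℝ)⁻¹ * ∑ j ∈ Finset.range n, Real.sin ⟪f, X j - smean n X⟫

lemma scovQF_neg (n : ℕ) (X : ℕ → H) (f : H) : scovQF n X (-f) = scovQF n X f := by
  simp [scovQF]

lemma centredCos_neg (n : ℕ) (X : ℕ → H) (f : H) :
    centredCos n X (-f) = centredCos n X f := by
  simp [centredCos, scovQF_neg]

lemma centredSin_neg (n : ℕ) (X : ℕ → H) (f : H) :
    centredSin n X (-f) = -centredSin n X f := by
  simp [centredSin]

lemma continuous_centredCos (n : ℕ) (X : ℕ → H) : Continuous (centredCos n X) := by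
  have := continuous_scovQF n X
  unfold centredCos
  fun_prop

lemma continuous_centredSin (n : ℕ) (X : ℕ → H) : Continuous (centredSin n X) := by
  unfold centredSin
  fun_prop

lemma abs_inv_mul_sum_range_le {n : ℕ} {a : ℕ → ℝ} {C : ℝ} (hC : 0 ≤ C)
    (ha : ∀ j, |a j| ≤ C) : |(n : ℝ)⁻¹ * ∑ j ∈ Finset.range n, a j| ≤ C := by
  rcases Nat.eq_zero_or_pos n with rfl | hn
  · simpa using hC
  have hn' : (0 : ℝ) < n := by exact_mod_cast hn
  rw [abs_mul, abs_of_pos (inv_pos.2 hn'), inv_mul_le_iff₀ hn']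
  calc |∑ j ∈ Finset.range n, a j| ≤ ∑ j ∈ Finset.range n, |a j| := Finset.abs_sum_le_sum_abs _ _
    _ ≤ ∑ _j ∈ Finset.range n, C := Finset.sum_le_sum fun j _ => ha j
    _ = n * C := by simp

lemma abs_centredCos_le (n : ℕ) (X : ℕ → H) (f : H) : |centredCos n X f| ≤ 2 := by
  refine abs_inv_mul_sum_range_le (by norm_num) fun j => ?_
  have h : Real.exp (- scovQF n X f / 2) ≤ 1 :=
    Real.exp_le_one_iff.2 (by linarith [scovQF_nonneg n X f])
  have h' := Real.exp_pos (- scovQF n X f / 2)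
  have hc := Real.neg_one_le_cos ⟪f, X j - smean n X⟫
  have hc' := Real.cos_le_one ⟪f, X j - smean n X⟫
  rw [abs_le]
  constructor <;> linarith

lemma abs_centredSin_le (n : ℕ) (X : ℕ → H) (f : H) : |centredSin n X f| ≤ 1 :=
  abs_inv_mul_sum_range_le zero_le_one fun _ => Real.abs_sin_le_one _

lemma ecf_sub_gcf_eq {n : ℕ} (hn : 0 < n) (X : ℕ → H) (f : H) :
    ecf n X f - gcf (smean n X) (scovQF n X) f =
      Complex.exp ((⟪smean n X, f⟫ : ℝ) * Complex.I) *
        (centredCos n X f + centredSin n X f * Complex.I) := by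
  have hn' : (n : ℂ) ≠ 0 := by exact_mod_cast hn.ne'
  have hterm : ∀ j, Complex.exp (Complex.I * (⟪f, X j⟫ : ℝ)) =
      Complex.exp ((⟪smean n X, f⟫ : ℝ) * Complex.I) *
        ((Real.cos ⟪f, X j - smean n X⟫ : ℝ) +
          (Real.sin ⟪f, X j - smean n X⟫ : ℝ) * Complex.I) := fun j => by
    rw [Complex.ofReal_cos, Complex.ofReal_sin, ← Complex.exp_mul_I, ← Complex.exp_add,
      inner_sub_right, real_inner_comm f (smean n X)]
    push_cast
    ring_nf
  have hg : gcf (smean n X) (scovQF n X) f =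
      Complex.exp ((⟪smean n X, f⟫ : ℝ) * Complex.I) *
        (Real.exp (- scovQF n X f / 2) : ℝ) := by
    rw [gcf, Complex.ofReal_exp, ← Complex.exp_add]
    push_cast
    ring_nf
  rw [ecf, hg, Finset.sum_congr rfl fun j _ => hterm j, ← Finset.mul_sum, centredCos, centredSin,
    Finset.sum_sub_distrib, Finset.sum_add_distrib, ← Finset.sum_mul]
  simp only [Finset.sum_const, Finset.card_range, nsmul_eq_mul, Complex.ofReal_mul,
    Complex.ofReal_sub, Complex.ofReal_sum, Complex.ofReal_inv, Complex.ofReal_natCast]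
  field_simp
  ring

lemma norm_ecf_sub_gcf_sq_s1 {n : ℕ} (hn : 0 < n) (X : ℕ → H) (f : H) :
    ‖ecf n X f - gcf (smean n X) (scovQF n X) f‖ ^ 2 =
      centredCos n X f ^ 2 + centredSin n X f ^ 2 := by
  rw [ecf_sub_gcf_eq hn, norm_mul, Complex.norm_exp_ofReal_mul_I, one_mul, Complex.sq_norm,
    Complex.normSq_add_mul_I]

lemma Vn_sq {n : ℕ} (hn : 0 < n) (X : ℕ → H) (f : H) :
    Vn n X f ^ 2 = n * (centredCos n X f ^ 2 + centredSin n X f ^ 2) +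
      2 * n * (centredCos n X f * centredSin n X f) := by
  have hn' : (n : ℝ) ≠ 0 := by exact_mod_cast hn.ne'
  have hsum : ∑ j ∈ Finset.range n, (Real.cos ⟪f, X j - smean n X⟫ +
      Real.sin ⟪f, X j - smean n X⟫ - Real.exp (- scovQF n X f / 2)) =
      n * (centredCos n X f + centredSin n X f) := by
    rw [centredCos, centredSin, ← mul_add, mul_inv_cancel_left₀ hn', ← Finset.sum_add_distrib]
    exact Finset.sum_congr rfl fun j _ => by ring
  rw [Vn, hsum, mul_pow, inv_pow, Real.sq_sqrt n.cast_nonneg]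
  field_simp
  ring

lemma integral_eq_zero_of_odd {E : Type*} [TopologicalSpace E] [Neg E] [ContinuousNeg E]
    [MeasurableSpace E] [BorelSpace E] {Q : Measure E}
    (hQ : Q.map (fun x => -x) = Q) {g : E → ℝ} (hg : Continuous g) (hodd : ∀ f, g (-f) = -g f) :
    ∫ f, g f ∂Q = 0 := by
  have h : ∫ f, g f ∂Q = -∫ f, g f ∂Q := by
    conv_lhs => rw [← hQ]
    rw [integral_map continuous_neg.measurable.aemeasurable hg.measurable.aestronglyMeasurable]
    simp_rw [hodd, integral_neg]
  linarith

/-- if `Q` is symmetric, then `n·T_n = ∫_H V_n(f)² Q(df)`. -/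
theorem statement1 [MeasurableSpace H] [BorelSpace H]
    (Q : Measure H) [IsProbabilityMeasure Q]
    (hQsymm : Q.map (fun x => -x) = Q)
    (n : ℕ) (hn : 0 < n) (X : ℕ → H) :
    (n : ℝ) * ∫ f, ‖ecf n X f - gcf (smean n X) (scovQF n X) f‖ ^ 2 ∂Q
      = ∫ f, (Vn n X f) ^ 2 ∂Q := by
  have hcos := continuous_centredCos n X
  have hsin := continuous_centredSin n X
  have hcosi : MemLp (centredCos n X) 2 Q :=
    MemLp.of_bound hcos.measurable.aestronglyMeasurable 2 (.of_forall (abs_centredCos_le n X))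
  have hsini : MemLp (centredSin n X) 2 Q :=
    MemLp.of_bound hsin.measurable.aestronglyMeasurable 1 (.of_forall (abs_centredSin_le n X))
  have hodd : ∫ f, centredCos n X f * centredSin n X f ∂Q = 0 :=
    integral_eq_zero_of_odd hQsymm (hcos.mul hsin) fun f => by
      rw [centredCos_neg, centredSin_neg, mul_neg]
  have hsq : Integrable (fun f => (n : ℝ) * (centredCos n X f ^ 2 + centredSin n X f ^ 2)) Q :=
    (hcosi.integrable_sq.add hsini.integrable_sq).const_mul _
  have hmul : Integrable (fun f => 2 * (n : ℝ) * (centredCos n X f * centredSin n X f)) Q :=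
    (hcosi.integrable_mul hsini).const_mul _
  simp_rw [norm_ecf_sub_gcf_sq_s1 hn, Vn_sq hn]
  rw [integral_add hsq hmul, integral_const_mul, integral_const_mul, hodd, mul_zero, add_zero]

end
end

section
/- Let X be a centred Gaussian random element of H with covariance operator C, and for f, x ∈ H set Ψ(f,x) = cos⟨f,x⟩ + sin⟨f,x⟩ − exp(−½σ_f²){ 1 + ⟨f,x⟩ − ½(⟨f,x⟩² − σ_f²) }, where σ_{f,g} = ⟨C f, g⟩ and σ_f² = σ_{f,f}. Then for every f, g ∈ H: E[Ψ(f,X)] = 0 and E[Ψ(f,X)Ψ(g,X)] = exp(−½(σ_f² + σ_g²)) { exp(σ_{f,g}) − 1 − σ_{f,g} − ½ σ_{f,g}² }. -/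
open MeasureTheory ProbabilityTheory Filter
open scoped RealInnerProductSpace BigOperators Topology

noncomputable section

variable {H : Type*} [NormedAddCommGroup H] [InnerProductSpace ℝ H]

/-- `Ψ(f,x)`, where `c f = ⟪C f, f⟫ = σ_f²`. -/
def Psi (c : H → ℝ) (f x : H) : ℝ :=
  Real.cos ⟪f, x⟫ + Real.sin ⟪f, x⟫
    - Real.exp (- c f / 2) * (1 + ⟪f, x⟫ - ((⟪f, x⟫ : ℝ) ^ 2 - c f) / 2)

section Moments

variable {Ω : Type*} [MeasurableSpace Ω] {P : Measure Ω}

/-- `Z` is integrable with integral `m`. -/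
structure HasMean (P : Measure Ω) (Z : Ω → ℝ) (m : ℝ) : Prop where
  integrable : Integrable Z P
  integral_eq : ∫ ω, Z ω ∂P = m

namespace HasMean

variable {Y Z : Ω → ℝ} {m n : ℝ}

theorem add (hY : HasMean P Y m) (hZ : HasMean P Z n) :
    HasMean P (fun ω => Y ω + Z ω) (m + n) :=
  ⟨hY.integrable.add hZ.integrable, by
    rw [integral_add hY.integrable hZ.integrable, hY.integral_eq, hZ.integral_eq]⟩

theorem const_mul (hY : HasMean P Y m) (c : ℝ) : HasMean P (fun ω => c * Y ω) (c * m) :=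
  ⟨hY.integrable.const_mul c, by rw [integral_const_mul, hY.integral_eq]⟩

theorem sub (hY : HasMean P Y m) (hZ : HasMean P Z n) :
    HasMean P (fun ω => Y ω - Z ω) (m - n) :=
  ⟨hY.integrable.sub hZ.integrable, by
    rw [integral_sub hY.integrable hZ.integrable, hY.integral_eq, hZ.integral_eq]⟩

theorem congr (hY : HasMean P Y m) (h : ∀ ω, Z ω = Y ω) (hn : n = m) : HasMean P Z n := by
  obtain rfl : Z = Y := funext h
  exact hn ▸ hY

end HasMean

theorem integrable_mul_cos {Z W : Ω → ℝ} (hZ : Integrable Z P) (hW : Measurable W) :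
    Integrable (fun ω => Z ω * Real.cos (W ω)) P :=
  hZ.mul_bdd (c := 1) (by fun_prop) (ae_of_all _ fun ω => Real.abs_cos_le_one _)

theorem hasDerivAt_integral_mul_cos {Z W V : Ω → ℝ} (hW : Measurable W) (hV : Measurable V)
    (hZ : Integrable Z P) (hZV : Integrable (fun ω => Z ω * V ω) P) (t : ℝ) :
    HasDerivAt (fun t => ∫ ω, Z ω * Real.cos (W ω + t * V ω) ∂P)
      (∫ ω, Z ω * V ω * Real.cos (W ω + t * V ω + Real.pi / 2) ∂P) t := by
  refine (hasDerivAt_integral_of_dominated_loc_of_deriv_le (s := Set.univ)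
    (F := fun t ω => Z ω * Real.cos (W ω + t * V ω))
    (F' := fun t ω => Z ω * V ω * Real.cos (W ω + t * V ω + Real.pi / 2))
    (bound := fun ω => ‖Z ω * V ω‖) univ_mem
    (Eventually.of_forall fun u => (integrable_mul_cos hZ (by fun_prop)).aestronglyMeasurable)
    (integrable_mul_cos hZ (by fun_prop))
    (integrable_mul_cos hZV (by fun_prop)).aestronglyMeasurable
    (ae_of_all _ fun ω u _ => ?_) hZV.norm (ae_of_all _ fun ω u _ => ?_)).2
  · rw [norm_mul]
    exact mul_le_of_le_one_right (norm_nonneg _) (Real.abs_cos_le_one _)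
  · have h : HasDerivAt (fun u => W ω + u * V ω) (V ω) u := by
      simpa using ((hasDerivAt_id u).mul_const (V ω)).const_add (W ω)
    convert! h.cos.const_mul (Z ω) using 1
    rw [Real.cos_add_pi_div_two]
    ring

/-- `(U, V)` is a centred Gaussian pair with variances `a`, `b` and covariance `s`, expressed
through its characteristic function. -/
structure IsCenteredGaussianPair (P : Measure Ω) (U V : Ω → ℝ) (a b s : ℝ) : Prop where
  measurable_left : Measurable U
  measurable_right : Measurable V
  memLp_left : ∀ n : ℕ, MemLp U n P
  memLp_right : ∀ n : ℕ, MemLp V n P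
  integral_cos : ∀ x y c : ℝ, ∫ ω, Real.cos (x * U ω + y * V ω + c) ∂P
    = Real.cos c * Real.exp (-(x ^ 2 * a + 2 * x * y * s + y ^ 2 * b) / 2)

namespace IsCenteredGaussianPair

variable {U V : Ω → ℝ} {a b s : ℝ}

theorem symm (h : IsCenteredGaussianPair P U V a b s) : IsCenteredGaussianPair P V U b a s where
  measurable_left := h.measurable_right
  measurable_right := h.measurable_left
  memLp_left := h.memLp_right
  memLp_right := h.memLp_left
  integral_cos x y c := by
    convert h.integral_cos y x c using 3 <;> ring_nf

variable [IsProbabilityMeasure P]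

theorem integrable_pow_mul_pow (h : IsCenteredGaussianPair P U V a b s) (i j : ℕ) :
    Integrable (fun ω => U ω ^ i * V ω ^ j) P := by
  have memLp_pow {W : Ω → ℝ} (hW : Measurable W) (hL : ∀ n : ℕ, MemLp W n P) (n : ℕ) :
      MemLp (fun ω => W ω ^ n) 2 P := by
    refine (memLp_two_iff_integrable_sq (by fun_prop)).2 ?_
    convert (hL (n * 2)).integrable_norm_pow' using 2 with ω
    rw [pow_mul, ← norm_pow, Real.norm_eq_abs, sq_abs]
  exact (memLp_pow h.measurable_left h.memLp_left i).integrable_mul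
    (memLp_pow h.measurable_right h.memLp_right j)

theorem hasMean_cos (h : IsCenteredGaussianPair P U V a b s) (x y c : ℝ) :
    HasMean P (fun ω => Real.cos (x * U ω + y * V ω + c))
      (Real.cos c * Real.exp (-(x ^ 2 * a + 2 * x * y * s + y ^ 2 * b) / 2)) := by
  refine ⟨?_, h.integral_cos x y c⟩
  have := h.measurable_left
  have := h.measurable_right
  simpa using integrable_mul_cos (P := P) (integrable_const (1 : ℝ))
    (W := fun ω => x * U ω + y * V ω + c) (by fun_prop)

theorem hasDerivAt_exp_right (a b s x y : ℝ) :
    HasDerivAt (fun y => Real.exp (-(x ^ 2 * a + 2 * x * y * s + y ^ 2 * b) / 2))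
      (-(x * s + y * b) * Real.exp (-(x ^ 2 * a + 2 * x * y * s + y ^ 2 * b) / 2)) y := by
  have h : HasDerivAt (fun y => -(x ^ 2 * a + 2 * x * y * s + y ^ 2 * b) / 2)
      (-(x * s + y * b)) y := by
    convert! (((((hasDerivAt_id y).const_mul (2 * x)).mul_const s).const_add (x ^ 2 * a)).add
      (((hasDerivAt_id y).pow 2).mul_const b)).neg.div_const 2 using 1
    simp
    ring
  convert! h.exp using 1
  ring

/-- If `∫ Z cos(xU + yV + c)` is known for all `y` and `c`, differentiating in `y` gives
`∫ Z V cos(xU + yV + c)`. -/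
theorem hasMean_mul_right (h : IsCenteredGaussianPair P U V a b s) {Z : Ω → ℝ} {i j : ℕ}
    (hZ : ∀ ω, Z ω = U ω ^ i * V ω ^ j) {x : ℝ} {F : ℝ → ℝ → ℝ}
    (hF : ∀ y c, ∫ ω, Z ω * Real.cos (x * U ω + y * V ω + c) ∂P = F y c)
    {y c F' : ℝ} (hF' : HasDerivAt (fun y => F y (c - Real.pi / 2)) F' y) :
    HasMean P (fun ω => Z ω * V ω * Real.cos (x * U ω + y * V ω + c)) F' := by
  have hU := h.measurable_left
  have hV := h.measurable_right
  have hZi : Integrable Z P := by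
    rw [funext hZ]; exact h.integrable_pow_mul_pow i j
  have hZV : Integrable (fun ω => Z ω * V ω) P := by
    simpa only [hZ, mul_assoc, ← pow_succ] using h.integrable_pow_mul_pow i (j + 1)
  refine ⟨integrable_mul_cos hZV (by fun_prop), ?_⟩
  have key := hasDerivAt_integral_mul_cos (W := fun ω => x * U ω + (c - Real.pi / 2))
    (by fun_prop) hV hZi hZV y
  have e : (fun y => F y (c - Real.pi / 2)) =
      fun t => ∫ ω, Z ω * Real.cos (x * U ω + (c - Real.pi / 2) + t * V ω) ∂P := by
    funext t
    rw [← hF]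
    simp only [add_right_comm]
  rw [e] at hF'
  rw [← key.unique hF']
  congr! 4
  ring

theorem hasMean_right_mul_cos (h : IsCenteredGaussianPair P U V a b s) (x y c : ℝ) :
    HasMean P (fun ω => V ω * Real.cos (x * U ω + y * V ω + c))
      (-Real.sin c * (x * s + y * b) *
        Real.exp (-(x ^ 2 * a + 2 * x * y * s + y ^ 2 * b) / 2)) := by
  refine (h.hasMean_mul_right (Z := fun _ => 1) (i := 0) (j := 0) (by simp) (x := x) (y := y)
    (c := c) (fun y c => by simpa only [one_mul] using h.integral_cos x y c)
    ((hasDerivAt_exp_right a b s x y).const_mul _)).congr (by simp) ?_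
  rw [Real.cos_sub_pi_div_two]
  ring

theorem hasMean_right_sq_mul_cos (h : IsCenteredGaussianPair P U V a b s) (x y c : ℝ) :
    HasMean P (fun ω => V ω ^ 2 * Real.cos (x * U ω + y * V ω + c))
      (Real.cos c * ((b - (x * s + y * b) ^ 2) *
        Real.exp (-(x ^ 2 * a + 2 * x * y * s + y ^ 2 * b) / 2))) := by
  have hL : HasDerivAt (fun y => x * s + y * b) b y := by
    simpa using ((hasDerivAt_id y).mul_const b).const_add (x * s)
  refine (h.hasMean_mul_right (i := 0) (j := 1) (by simp) (x := x) (y := y)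
    (c := c) (fun y c => (h.hasMean_right_mul_cos x y c).integral_eq)
    ((hL.const_mul _).mul (hasDerivAt_exp_right a b s x y))).congr (fun ω => by ring) ?_
  rw [Real.sin_sub_pi_div_two]
  ring

theorem hasMean_left_sq_mul_right_mul_cos (h : IsCenteredGaussianPair P U V a b s)
    (x y c : ℝ) :
    HasMean P (fun ω => U ω ^ 2 * V ω * Real.cos (x * U ω + y * V ω + c))
      (-Real.sin c * (((2 * s * (x * a + y * s)) + (a - (x * a + y * s) ^ 2) * (x * s + y * b)) *
        Real.exp (-(x ^ 2 * a + 2 * x * y * s + y ^ 2 * b) / 2))) := by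
  have hL : HasDerivAt (fun y => a - (x * a + y * s) ^ 2) (-(2 * (x * a + y * s) * s)) y := by
    have hM : HasDerivAt (fun y => x * a + y * s) s y := by
      simpa using ((hasDerivAt_id y).mul_const s).const_add (x * a)
    simpa using (hM.pow 2).const_sub a
  refine (h.hasMean_mul_right (Z := fun ω => U ω ^ 2) (i := 2) (j := 0) (by simp) (x := x) (y := y)
    (c := c) (F := fun y c => Real.cos c * ((a - (x * a + y * s) ^ 2) *
      Real.exp (-(x ^ 2 * a + 2 * x * y * s + y ^ 2 * b) / 2))) (fun y c => ?_)
    ((hL.mul (hasDerivAt_exp_right a b s x y)).const_mul _)).congr (fun ω => by ring) ?_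
  · convert (h.symm.hasMean_right_sq_mul_cos y x c).integral_eq using 1
    · simp only [add_comm (x * U _)]
    · ring_nf
  · rw [Real.cos_sub_pi_div_two]
    ring

theorem hasMean_left_sq_mul_right_sq (h : IsCenteredGaussianPair P U V a b s) :
    HasMean P (fun ω => U ω ^ 2 * V ω ^ 2) (a * b + 2 * s ^ 2) := by
  have hL : HasDerivAt (fun y => 2 * s * (0 * a + y * s) +
      (a - (0 * a + y * s) ^ 2) * (0 * s + y * b)) (2 * s ^ 2 + a * b) 0 := by
    have hM (r q : ℝ) : HasDerivAt (fun y => 0 * q + y * r) r 0 := by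
      simpa using ((hasDerivAt_id (0 : ℝ)).mul_const r).const_add (0 * q)
    convert! ((hM s a).const_mul (2 * s)).add
      ((((hM s a).pow 2).const_sub a).mul (hM b s)) using 1
    simp
    ring
  refine (h.hasMean_mul_right (i := 2) (j := 1) (by simp) (x := 0) (y := 0) (c := 0)
    (fun y c => (h.hasMean_left_sq_mul_right_mul_cos 0 y c).integral_eq)
    ((hL.mul (hasDerivAt_exp_right a b s 0 0)).const_mul _)).congr
    (fun ω => by simp; ring) ?_
  simp
  ring

theorem hasMean_left_mul_right (h : IsCenteredGaussianPair P U V a b s) :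
    HasMean P (fun ω => U ω * V ω) s := by
  have hL : HasDerivAt (fun y => 0 * a + y * s) s 0 := by
    simpa using ((hasDerivAt_id (0 : ℝ)).mul_const s).const_add (0 * a)
  refine (h.hasMean_mul_right (Z := U) (i := 1) (j := 0) (by simp) (x := 0) (y := 0) (c := 0)
    (F := fun y c => -Real.sin c * ((0 * a + y * s) *
      Real.exp (-(0 ^ 2 * a + 2 * 0 * y * s + y ^ 2 * b) / 2))) (fun y c => ?_)
    ((hL.mul (hasDerivAt_exp_right a b s 0 0)).const_mul _)).congr (by simp) (by simp)
  convert (h.symm.hasMean_right_mul_cos y 0 c).integral_eq using 1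
  · simp only [add_comm (0 * U _)]
  · ring_nf

theorem hasMean_right (h : IsCenteredGaussianPair P U V a b s) : HasMean P V 0 :=
  (h.hasMean_right_mul_cos 0 0 0).congr (by simp) (by simp)

theorem hasMean_right_sq (h : IsCenteredGaussianPair P U V a b s) :
    HasMean P (fun ω => V ω ^ 2) b :=
  (h.hasMean_right_sq_mul_cos 0 0 0).congr (by simp) (by simp)

theorem hasMean_left_sq_mul_right (h : IsCenteredGaussianPair P U V a b s) :
    HasMean P (fun ω => U ω ^ 2 * V ω) 0 :=
  (h.hasMean_left_sq_mul_right_mul_cos 0 0 0).congr (by simp) (by simp)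

theorem hasMean_cos_add_sin (h : IsCenteredGaussianPair P U V a b s) :
    HasMean P (fun ω => Real.cos (U ω) + Real.sin (U ω)) (Real.exp (-a / 2)) :=
  ((h.hasMean_cos 1 0 0).add (h.hasMean_cos 1 0 (-(Real.pi / 2)))).congr
    (fun ω => by simp [← sub_eq_add_neg, Real.cos_sub_pi_div_two]) (by simp)

theorem hasMean_right_mul_cos_add_sin (h : IsCenteredGaussianPair P U V a b s) :
    HasMean P (fun ω => V ω * (Real.cos (U ω) + Real.sin (U ω))) (s * Real.exp (-a / 2)) :=
  ((h.hasMean_right_mul_cos 1 0 0).add (h.hasMean_right_mul_cos 1 0 (-(Real.pi / 2)))).congr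
    (fun ω => by simp [← sub_eq_add_neg, Real.cos_sub_pi_div_two, mul_add]) (by simp)

theorem hasMean_right_sq_mul_cos_add_sin (h : IsCenteredGaussianPair P U V a b s) :
    HasMean P (fun ω => V ω ^ 2 * (Real.cos (U ω) + Real.sin (U ω)))
      ((b - s ^ 2) * Real.exp (-a / 2)) :=
  ((h.hasMean_right_sq_mul_cos 1 0 0).add
    (h.hasMean_right_sq_mul_cos 1 0 (-(Real.pi / 2)))).congr
    (fun ω => by simp [← sub_eq_add_neg, Real.cos_sub_pi_div_two, mul_add]) (by simp)

theorem hasMean_cos_add_sin_mul (h : IsCenteredGaussianPair P U V a b s) :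
    HasMean P (fun ω => (Real.cos (U ω) + Real.sin (U ω)) * (Real.cos (V ω) + Real.sin (V ω)))
      (Real.exp (-(a + b) / 2) * Real.exp s) := by
  refine ((h.hasMean_cos 1 (-1) 0).add (h.hasMean_cos 1 1 (-(Real.pi / 2)))).congr
    (fun ω => ?_) ?_
  · simp only [one_mul, neg_one_mul, add_zero, ← sub_eq_add_neg, Real.cos_sub_pi_div_two]
    rw [Real.cos_sub, Real.sin_add]
    ring
  · rw [← Real.exp_add]
    simp
    ring

/-- The product of `cos + sin` of `U` with a quadratic polynomial in `V`. -/
theorem hasMean_cos_add_sin_mul_quadratic (h : IsCenteredGaussianPair P U V a b s) :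
    HasMean P (fun ω => (Real.cos (U ω) + Real.sin (U ω)) * (1 + V ω - (V ω ^ 2 - b) / 2))
      (Real.exp (-a / 2) * (1 + s + s ^ 2 / 2)) :=
  (((h.hasMean_cos_add_sin.const_mul (1 + b / 2)).add h.hasMean_right_mul_cos_add_sin).sub
    (h.hasMean_right_sq_mul_cos_add_sin.const_mul (1 / 2))).congr (fun ω => by ring) (by ring)

theorem hasMean_quadratic (h : IsCenteredGaussianPair P U V a b s) :
    HasMean P (fun ω => 1 + V ω - (V ω ^ 2 - b) / 2) 1 := by
  have h1 : HasMean P (fun _ => (1 : ℝ)) 1 := ⟨integrable_const _, by simp⟩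
  exact (((h1.const_mul (1 + b / 2)).add h.hasMean_right).sub
    (h.hasMean_right_sq.const_mul (1 / 2))).congr (fun ω => by ring) (by ring)

theorem hasMean_quadratic_mul_quadratic (h : IsCenteredGaussianPair P U V a b s) :
    HasMean P (fun ω => (1 + U ω - (U ω ^ 2 - a) / 2) * (1 + V ω - (V ω ^ 2 - b) / 2))
      (1 + s + s ^ 2 / 2) := by
  refine ((((((h.hasMean_quadratic.const_mul (1 + a / 2)).add
    (h.symm.hasMean_right.const_mul (1 + b / 2))).add h.hasMean_left_mul_right).sub
    (h.symm.hasMean_left_sq_mul_right.const_mul (1 / 2))).sub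
    (h.symm.hasMean_right_sq.const_mul (1 / 2 * (1 + b / 2)))).sub
    (h.hasMean_left_sq_mul_right.const_mul (1 / 2))).add
    (h.hasMean_left_sq_mul_right_sq.const_mul (1 / 4)) |>.congr (fun ω => ?_) ?_ <;> ring

theorem hasMean_remainder (h : IsCenteredGaussianPair P U V a b s) :
    HasMean P (fun ω => Real.cos (V ω) + Real.sin (V ω)
      - Real.exp (-b / 2) * (1 + V ω - (V ω ^ 2 - b) / 2)) 0 :=
  (h.symm.hasMean_cos_add_sin.sub (h.hasMean_quadratic.const_mul (Real.exp (-b / 2)))).congr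
    (fun _ => rfl) (by ring)

theorem hasMean_remainder_mul_remainder (h : IsCenteredGaussianPair P U V a b s) :
    HasMean P (fun ω =>
      (Real.cos (U ω) + Real.sin (U ω)
        - Real.exp (-a / 2) * (1 + U ω - (U ω ^ 2 - a) / 2)) *
      (Real.cos (V ω) + Real.sin (V ω)
        - Real.exp (-b / 2) * (1 + V ω - (V ω ^ 2 - b) / 2)))
      (Real.exp (-(a + b) / 2) * (Real.exp s - 1 - s - s ^ 2 / 2)) := by
  refine (((h.hasMean_cos_add_sin_mul.sub
    (h.hasMean_cos_add_sin_mul_quadratic.const_mul (Real.exp (-b / 2)))).sub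
    (h.symm.hasMean_cos_add_sin_mul_quadratic.const_mul (Real.exp (-a / 2)))).add
    (h.hasMean_quadratic_mul_quadratic.const_mul
      (Real.exp (-a / 2) * Real.exp (-b / 2)))).congr (fun ω => by ring) ?_
  rw [show -(a + b) / 2 = -a / 2 + -b / 2 by ring, Real.exp_add]
  ring

end IsCenteredGaussianPair

theorem integral_cos_add_of_map_eq_gaussianReal {W : Ω → ℝ} (hW : Measurable W) {v : NNReal}
    (h : P.map W = gaussianReal 0 v) (c : ℝ) [IsProbabilityMeasure P] :
    ∫ ω, Real.cos (W ω + c) ∂P = Real.cos c * Real.exp (-v / 2) := by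
  have hint : Integrable (fun ω => Complex.exp (W ω * Complex.I)) P := by
    refine (integrable_const (1 : ℝ)).mono' (by fun_prop) (ae_of_all _ fun ω => ?_)
    rw [Complex.norm_exp_ofReal_mul_I]
  have hchar : ∫ ω, Complex.exp (W ω * Complex.I) ∂P = Complex.exp ((-v / 2 : ℝ) : ℂ) := by
    have := charFun_gaussianReal (μ := 0) (v := v) 1
    rw [← h, charFun_apply_real, integral_map hW.aemeasurable (by fun_prop)] at this
    simpa [neg_div] using this
  have hc : ∫ ω, Complex.exp (c * Complex.I) * Complex.exp (W ω * Complex.I) ∂P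
      = Complex.exp (c * Complex.I) * Complex.exp ((-v / 2 : ℝ) : ℂ) := by
    rw [integral_const_mul, hchar]
  have hre := congrArg Complex.re hc
  rw [← RCLike.re_eq_complex_re, ← integral_re (hint.const_mul _)] at hre
  convert hre using 1
  · refine integral_congr_ae (ae_of_all _ fun ω => ?_)
    simp only [RCLike.re_eq_complex_re, ← Complex.exp_add, ← add_mul, ← Complex.ofReal_add,
      Complex.exp_ofReal_mul_I_re, add_comm c]
  · rw [← Complex.ofReal_exp, RCLike.re_eq_complex_re, Complex.re_mul_ofReal,
      Complex.exp_ofReal_mul_I_re]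

theorem memLp_of_map_eq_gaussianReal {W : Ω → ℝ} (hW : Measurable W) {v : NNReal}
    (h : P.map W = gaussianReal 0 v) (n : ℕ) : MemLp W n P := by
  have := memLp_id_gaussianReal' (μ := 0) (v := v) n (by simp)
  rw [← h] at this
  exact (memLp_map_measure_iff (by fun_prop) hW.aemeasurable).1 this

end Moments

theorem isCenteredGaussianPair_inner
    [MeasurableSpace H] [BorelSpace H] [SecondCountableTopology H]
    {Ω : Type*} [MeasurableSpace Ω] {P : Measure Ω} [IsProbabilityMeasure P]
    {X : Ω → H} (hmeas : Measurable X) {C : H →L[ℝ] H}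
    (hC : ∀ f g : H, ⟪C f, g⟫ = ∫ ω, ⟪X ω, f⟫ * ⟪X ω, g⟫ ∂P)
    (hGauss : ∀ f : H,
      P.map (fun ω => ⟪X ω, f⟫) = gaussianReal 0 (⟪C f, f⟫).toNNReal) (f g : H) :
    IsCenteredGaussianPair P (fun ω => ⟪f, X ω⟫) (fun ω => ⟪g, X ω⟫)
      ⟪C f, f⟫ ⟪C g, g⟫ ⟪C f, g⟫ := by
  have hm (k : H) : Measurable fun ω => ⟪k, X ω⟫ := by fun_prop
  have hG (k : H) : P.map (fun ω => ⟪k, X ω⟫) = gaussianReal 0 (⟪C k, k⟫).toNNReal := by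
    simpa only [real_inner_comm] using hGauss k
  refine ⟨hm f, hm g, memLp_of_map_eq_gaussianReal (hm f) (hG f),
    memLp_of_map_eq_gaussianReal (hm g) (hG g), fun x y c => ?_⟩
  have hsymm : ⟪C g, f⟫ = ⟪C f, g⟫ := by simp only [hC, mul_comm]
  have hnonneg : 0 ≤ ⟪C (x • f + y • g), x • f + y • g⟫ := by
    rw [hC]
    exact integral_nonneg fun ω => mul_self_nonneg _
  have key := integral_cos_add_of_map_eq_gaussianReal (hm _) (hG (x • f + y • g)) c
  rw [Real.coe_toNNReal _ hnonneg] at key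
  simp only [map_add, map_smul, inner_add_left, inner_add_right, real_inner_smul_left,
    real_inner_smul_right, hsymm] at key
  rw [key]
  ring_nf

/-- for a centred Gaussian `X` with covariance operator `C`,
`E[Ψ(f,X)] = 0` and
`E[Ψ(f,X)Ψ(g,X)] = exp(−½(σ_f²+σ_g²)){exp(σ_{f,g}) − 1 − σ_{f,g} − ½σ_{f,g}²}`. -/
theorem statement8
    [MeasurableSpace H] [BorelSpace H] [SecondCountableTopology H] [CompleteSpace H]
    {Ω : Type*} [MeasurableSpace Ω] (P : Measure Ω) [IsProbabilityMeasure P]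
    (X : Ω → H) (hmeas : Measurable X)
    (C : H →L[ℝ] H)
    (hC : ∀ f g : H, ⟪C f, g⟫ = ∫ ω, ⟪X ω, f⟫ * ⟪X ω, g⟫ ∂P)
    (hGauss : ∀ f : H,
      P.map (fun ω => ⟪X ω, f⟫) = gaussianReal 0 (⟪C f, f⟫).toNNReal) :
    ∀ f g : H,
      (∫ ω, Psi (fun f => ⟪C f, f⟫) f (X ω) ∂P) = 0 ∧
      (∫ ω, Psi (fun f => ⟪C f, f⟫) f (X ω) * Psi (fun f => ⟪C f, f⟫) g (X ω) ∂P)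
        = Real.exp (-(⟪C f, f⟫ + ⟪C g, g⟫) / 2) *
            (Real.exp ⟪C f, g⟫ - 1 - ⟪C f, g⟫ - ⟪C f, g⟫ ^ 2 / 2) := by
  intro f g
  have h := isCenteredGaussianPair_inner hmeas hC hGauss
  exact ⟨(h f f).hasMean_remainder.integral_eq,
    (h f g).hasMean_remainder_mul_remainder.integral_eq⟩

end
end

section
/- (Proposition 1) Let X be a random element of H with E‖X‖²_H < ∞, mean zero and covariance operator C, and let Q be a symmetric Borel probability measure on H. Then τ_Q = ∫_H |φ_X(f) − exp(−½⟨C f,f⟩)|² Q(df) = ∫_H z(f)² Q(df), where z(f) = E[cos⟨f,X⟩] + E[sin⟨f,X⟩] − exp(−½σ_f²) and σ_f² = ⟨C f, f⟩. -/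
open MeasureTheory Filter
open scoped RealInnerProductSpace BigOperators Topology

noncomputable section

/-- Proposition 1: for a centred random element `X` with
`E‖X‖² < ∞` and covariance operator `C`, and a symmetric Borel probability
measure `Q`,
`τ_Q = ∫ |φ_X(f) − exp(−½σ_f²)|² Q(df) = ∫ z(f)² Q(df)`, where
`z(f) = E[cos⟪f,X⟫] + E[sin⟪f,X⟫] − exp(−½σ_f²)` and `σ_f² = ⟪C f, f⟫`. -/
theorem statement14
    {H : Type*} [NormedAddCommGroup H] [InnerProductSpace ℝ H]
    [MeasurableSpace H] [BorelSpace H] [SecondCountableTopology H] [CompleteSpace H]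
    {Ω : Type*} [MeasurableSpace Ω] (P : Measure Ω) [IsProbabilityMeasure P]
    (X : Ω → H) (hmeas : Measurable X)
    (hL2 : Integrable (fun ω => ‖X ω‖ ^ 2) P)
    (hcentred : ∀ f : H, (∫ ω, ⟪X ω, f⟫ ∂P) = 0)
    (C : H →L[ℝ] H)
    (hC : ∀ f g : H, ⟪C f, g⟫ = ∫ ω, ⟪X ω, f⟫ * ⟪X ω, g⟫ ∂P)
    (Q : Measure H) [IsProbabilityMeasure Q]
    (hQsymm : Q.map (fun x => -x) = Q) :
    (∫ f, ‖(∫ ω, Complex.exp (Complex.I * (⟪X ω, f⟫ : ℝ)) ∂P)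
        - (Real.exp (- ⟪C f, f⟫ / 2) : ℂ)‖ ^ 2 ∂Q)
      = ∫ f, ((∫ ω, Real.cos ⟪f, X ω⟫ ∂P) + (∫ ω, Real.sin ⟪f, X ω⟫ ∂P)
          - Real.exp (- ⟪C f, f⟫ / 2)) ^ 2 ∂Q := by
  set c : H → ℝ := fun f => ∫ ω, Real.cos ⟪f, X ω⟫ ∂P with hc
  set s : H → ℝ := fun f => ∫ ω, Real.sin ⟪f, X ω⟫ ∂P with hs
  set e : H → ℝ := fun f => Real.exp (- ⟪C f, f⟫ / 2) with he
  have hc_neg (f : H) : c (-f) = c f := by simp [hc]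
  have hs_neg (f : H) : s (-f) = -s f := by simp [hs, integral_neg]
  have he_neg (f : H) : e (-f) = e f := by simp [he]
  have hinner : Measurable fun p : H × Ω => ⟪p.1, X p.2⟫ :=
    measurable_fst.inner (hmeas.comp measurable_snd)
  have hc_meas : StronglyMeasurable c :=
    (Real.measurable_cos.comp hinner).stronglyMeasurable.integral_prod_right' (ν := P)
  have hs_meas : StronglyMeasurable s :=
    (Real.measurable_sin.comp hinner).stronglyMeasurable.integral_prod_right' (ν := P)
  have he_meas : StronglyMeasurable e :=
    (by fun_prop : Continuous e).measurable.stronglyMeasurable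
  have hc_bound (f : H) : |c f| ≤ 1 := by
    simpa using norm_integral_le_of_norm_le_const (μ := P) (C := 1) (f := fun ω => Real.cos ⟪f, X ω⟫)
      (.of_forall fun ω => Real.abs_cos_le_one ⟪f, X ω⟫)
  have hs_bound (f : H) : |s f| ≤ 1 := by
    simpa using norm_integral_le_of_norm_le_const (μ := P) (C := 1) (f := fun ω => Real.sin ⟪f, X ω⟫)
      (.of_forall fun ω => Real.abs_sin_le_one ⟪f, X ω⟫)
  have he_bound (f : H) : |e f| ≤ 1 := by
    have h : 0 ≤ ⟪C f, f⟫ := by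
      rw [hC]
      exact integral_nonneg fun ω => mul_self_nonneg _
    rw [abs_of_pos (Real.exp_pos _)]
    exact Real.exp_le_one_iff.2 (by linarith)
  have hz_int : Integrable (fun f => (c f + s f - e f) ^ 2) Q := by
    refine .of_bound (((hc_meas.add hs_meas).sub he_meas).pow 2).aestronglyMeasurable 9
      (.of_forall fun f => ?_)
    have h1 := abs_le.1 (hc_bound f)
    have h2 := abs_le.1 (hs_bound f)
    have h3 := abs_le.1 (he_bound f)
    rw [Real.norm_eq_abs, abs_of_nonneg (sq_nonneg _)]
    nlinarith
  have hlhs (f : H) : ‖(∫ ω, Complex.exp (Complex.I * (⟪X ω, f⟫ : ℝ)) ∂P)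
      - (e f : ℂ)‖ ^ 2 = (c f - e f) ^ 2 + s f ^ 2 := by
    have hX : Measurable fun ω => ⟪f, X ω⟫ := measurable_const.inner hmeas
    have hcos : Integrable (fun ω => Real.cos ⟪f, X ω⟫) P :=
      .of_bound (Real.measurable_cos.comp hX).aestronglyMeasurable 1
        (.of_forall fun ω => Real.abs_cos_le_one _)
    have hsin : Integrable (fun ω => Real.sin ⟪f, X ω⟫) P :=
      .of_bound (Real.measurable_sin.comp hX).aestronglyMeasurable 1
        (.of_forall fun ω => Real.abs_sin_le_one _)
    have h : (∫ ω, Complex.exp (Complex.I * (⟪X ω, f⟫ : ℝ)) ∂P)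
        = (c f : ℂ) + (s f : ℂ) * Complex.I := by
      rw [hc, hs]
      simp only []
      rw [← integral_complex_ofReal, ← integral_complex_ofReal, ← integral_mul_const,
        ← integral_add hcos.ofReal (hsin.ofReal.mul_const _)]
      refine integral_congr_ae (.of_forall fun ω => ?_)
      simp only []
      rw [mul_comm, Complex.exp_mul_I, real_inner_comm]
      simp
    rw [h, Complex.sq_norm, Complex.normSq_apply]
    simp
    ring
  have hneg : ∫ f, (c (-f) + s (-f) - e (-f)) ^ 2 ∂Q = ∫ f, (c f + s f - e f) ^ 2 ∂Q := by
    conv_rhs => rw [← hQsymm]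
    exact (integral_map_equiv (MeasurableEquiv.neg H) fun f => (c f + s f - e f) ^ 2).symm
  have hz_neg_int : Integrable (fun f => (c (-f) + s (-f) - e (-f)) ^ 2) Q := by
    rw [← hQsymm] at hz_int
    exact hz_int.comp_measurable measurable_neg
  calc ∫ f, ‖(∫ ω, Complex.exp (Complex.I * (⟪X ω, f⟫ : ℝ)) ∂P) - (e f : ℂ)‖ ^ 2 ∂Q
      = ∫ f, ((c f + s f - e f) ^ 2 + (c (-f) + s (-f) - e (-f)) ^ 2) / 2 ∂Q := by
        refine integral_congr_ae (.of_forall fun f => ?_)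
        simp only [hlhs, hc_neg, hs_neg, he_neg]
        ring
    _ = ∫ f, (c f + s f - e f) ^ 2 ∂Q := by
        rw [integral_div, integral_add hz_int hz_neg_int, hneg]
        ring

end
end

section
/- Let d ∈ ℕ, β > 0, and let Y_1,…,Y_n be points of ℝ^d. Then ∫_{ℝ^d} | n^{-1} Σ_{j=1}^n exp(i t·Y_j) − exp(−‖t‖²/2) |² w_{d,β}(t) dt = n^{-2} Σ_{j=1}^n Σ_{k=1}^n exp( −(β²/2) ‖Y_j − Y_k‖² ) − 2 n^{-1} (1+β²)^{-d/2} Σ_{j=1}^n exp( −β² ‖Y_j‖² / (2(1+β²)) ) + (1+2β²)^{-d/2}, where w_{d,β}(t) = (2πβ²)^{-d/2} exp(−‖t‖²/(2β²)) is the density of the N_d(0, β² I_d) distribution and ‖·‖ denotes the Euclidean norm on ℝ^d. -/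
open MeasureTheory Filter
open scoped RealInnerProductSpace BigOperators Topology

noncomputable section

/-- The cosine transform of a Gaussian on a finite-dimensional Euclidean space. -/
theorem integral_exp_neg_mul_sq_norm_mul_cos {d : ℕ} {a : ℝ} (ha : 0 < a)
    (w : EuclideanSpace ℝ (Fin d)) :
    Integrable (fun t : EuclideanSpace ℝ (Fin d) ↦
        Real.exp (-a * ‖t‖ ^ 2) * Real.cos ⟪t, w⟫) ∧
      ∫ t : EuclideanSpace ℝ (Fin d), Real.exp (-a * ‖t‖ ^ 2) * Real.cos ⟪t, w⟫ =
        (Real.pi / a) ^ ((d : ℝ) / 2) * Real.exp (-‖w‖ ^ 2 / (4 * a)) := by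
  have ha' : 0 < (a : ℂ).re := by simpa using ha
  have hint := GaussianFourier.integrable_cexp_neg_mul_sq_norm_add ha' Complex.I w
  have hval := GaussianFourier.integral_cexp_neg_mul_sq_norm_add ha' Complex.I w
  have hre : ∀ t : EuclideanSpace ℝ (Fin d),
      RCLike.re (Complex.exp (-(a : ℂ) * (‖t‖ : ℂ) ^ 2 + Complex.I * (⟪w, t⟫ : ℝ))) =
        Real.exp (-a * ‖t‖ ^ 2) * Real.cos ⟪t, w⟫ := by
    intro t
    rw [real_inner_comm]
    simp [Complex.exp_re, ← Complex.ofReal_pow]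
  have hre_int := integral_re hint
  refine ⟨by simpa only [hre] using hint.re, ?_⟩
  simp only [hre] at hre_int
  rw [hre_int, hval]
  have h2 : ((Real.pi : ℂ) / a) ^ (Module.finrank ℝ (EuclideanSpace ℝ (Fin d)) / 2 : ℂ) *
      Complex.exp (Complex.I ^ 2 * (‖w‖ : ℂ) ^ 2 / (4 * a)) =
      (((Real.pi / a) ^ ((d : ℝ) / 2) * Real.exp (-‖w‖ ^ 2 / (4 * a)) : ℝ) : ℂ) := by
    rw [Complex.ofReal_mul, Complex.ofReal_cpow (by positivity)]
    simp
  rw [h2]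
  exact Complex.ofReal_re _

/-- The cosine transform of a centred normal density multiplied by a Gaussian factor, written so
that `b = 1` gives the real part of the characteristic function. -/
theorem integral_normal_density_mul_cos {d : ℕ} {β b : ℝ} (hβ : 0 < β) (hb : 0 < b)
    (w : EuclideanSpace ℝ (Fin d)) :
    Integrable (fun t : EuclideanSpace ℝ (Fin d) ↦ (2 * Real.pi * β ^ 2) ^ (-(d : ℝ) / 2) *
        (Real.exp (-(b / (2 * β ^ 2)) * ‖t‖ ^ 2) * Real.cos ⟪t, w⟫)) ∧
      ∫ t : EuclideanSpace ℝ (Fin d), (2 * Real.pi * β ^ 2) ^ (-(d : ℝ) / 2) *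
          (Real.exp (-(b / (2 * β ^ 2)) * ‖t‖ ^ 2) * Real.cos ⟪t, w⟫) =
        b ^ (-(d : ℝ) / 2) * Real.exp (-β ^ 2 * ‖w‖ ^ 2 / (2 * b)) := by
  obtain ⟨hint, hval⟩ :=
    integral_exp_neg_mul_sq_norm_mul_cos (show 0 < b / (2 * β ^ 2) by positivity) w
  refine ⟨hint.const_mul _, ?_⟩
  rw [integral_const_mul, hval, ← mul_assoc]
  congr 1
  · have h : Real.pi / (b / (2 * β ^ 2)) = (2 * Real.pi * β ^ 2) / b := by field_simp
    have hc : 0 < 2 * Real.pi * β ^ 2 := by positivity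
    rw [h, Real.div_rpow hc.le hb.le, neg_div, Real.rpow_neg hc.le, Real.rpow_neg hb.le]
    have := (Real.rpow_pos_of_pos hc ((d : ℝ) / 2)).ne'
    field_simp
  · congr 1
    field_simp
    ring

theorem sq_sum_cos_add_sq_sum_sin_s19 {ι : Type*} [Fintype ι] (x : ι → ℝ) :
    (∑ j, Real.cos (x j)) ^ 2 + (∑ j, Real.sin (x j)) ^ 2 =
      ∑ j, ∑ k, Real.cos (x j - x k) := by
  simp_rw [sq, Finset.sum_mul_sum, ← Finset.sum_add_distrib, Real.cos_sub]

theorem norm_sq_mul_sum_cexp_sub {ι : Type*} [Fintype ι] (x : ι → ℝ) (m r : ℝ) :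
    ‖(m : ℂ) * (∑ j, Complex.exp (Complex.I * (x j : ℂ))) - (r : ℂ)‖ ^ 2 =
      m ^ 2 * ∑ j, ∑ k, Real.cos (x j - x k) - 2 * m * r * ∑ j, Real.cos (x j) + r ^ 2 := by
  rw [← sq_sum_cos_add_sq_sum_sin_s19, Complex.sq_norm, Complex.normSq_apply]
  simp [Complex.exp_re, Complex.exp_im]
  ring

/-- the closed-form representation of the BHEP statistic
`T_{n,d,β} = ∫_{ℝ^d} |n^{-1} Σ_j exp(i t·Y_j) − exp(−‖t‖²/2)|² w_{d,β}(t) dt`,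
where `w_{d,β}(t) = (2πβ²)^{-d/2} exp(−‖t‖²/(2β²))`. -/
theorem statement19 (d : ℕ) (β : ℝ) (hβ : 0 < β) (n : ℕ)
    (Y : Fin n → EuclideanSpace ℝ (Fin d)) :
    (∫ t : EuclideanSpace ℝ (Fin d),
        ‖(n : ℂ)⁻¹ * (∑ j, Complex.exp (Complex.I * (⟪t, Y j⟫ : ℝ)))
            - Complex.exp (- (‖t‖ ^ 2 : ℝ) / 2)‖ ^ 2
          * ((2 * Real.pi * β ^ 2) ^ (-(d : ℝ) / 2) * Real.exp (- ‖t‖ ^ 2 / (2 * β ^ 2))))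
      = ((n : ℝ) ^ 2)⁻¹ * ∑ j, ∑ k, Real.exp (- (β ^ 2 / 2) * ‖Y j - Y k‖ ^ 2)
        - 2 * (n : ℝ)⁻¹ * (1 + β ^ 2) ^ (-(d : ℝ) / 2) *
            ∑ j, Real.exp (- β ^ 2 * ‖Y j‖ ^ 2 / (2 * (1 + β ^ 2)))
        + (1 + 2 * β ^ 2) ^ (-(d : ℝ) / 2) := by
  have hint {b : ℝ} (hb : 0 < b) (w : EuclideanSpace ℝ (Fin d)) :=
    (integral_normal_density_mul_cos hβ hb w).1
  have hval {b : ℝ} (hb : 0 < b) (w : EuclideanSpace ℝ (Fin d)) :=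
    (integral_normal_density_mul_cos hβ hb w).2
  have h0 : (0 : ℝ) < 1 := one_pos
  have h1 : 0 < 1 + β ^ 2 := by positivity
  have h2 : 0 < 1 + 2 * β ^ 2 := by positivity
  set C : ℝ := (2 * Real.pi * β ^ 2) ^ (-(d : ℝ) / 2)
  let g (b : ℝ) (w t : EuclideanSpace ℝ (Fin d)) : ℝ :=
    C * (Real.exp (-(b / (2 * β ^ 2)) * ‖t‖ ^ 2) * Real.cos ⟪t, w⟫)
  have hpt (t : EuclideanSpace ℝ (Fin d)) :
      ‖(n : ℂ)⁻¹ * (∑ j, Complex.exp (Complex.I * (⟪t, Y j⟫ : ℝ)))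
          - Complex.exp (- (‖t‖ ^ 2 : ℝ) / 2)‖ ^ 2 * (C * Real.exp (- ‖t‖ ^ 2 / (2 * β ^ 2))) =
        ((n : ℝ) ^ 2)⁻¹ * ∑ j, ∑ k, g 1 (Y j - Y k) t
          - 2 * (n : ℝ)⁻¹ * ∑ j, g (1 + β ^ 2) (Y j) t + g (1 + 2 * β ^ 2) 0 t := by
    have hr : Complex.exp (- (‖t‖ ^ 2 : ℝ) / 2) = ((Real.exp (-‖t‖ ^ 2 / 2) : ℝ) : ℂ) := by
      push_cast; rfl
    have hn : (n : ℂ)⁻¹ = (((n : ℝ)⁻¹ : ℝ) : ℂ) := by push_cast; rfl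
    have e0 : Real.exp (-(1 / (2 * β ^ 2)) * ‖t‖ ^ 2) =
        Real.exp (- ‖t‖ ^ 2 / (2 * β ^ 2)) := by
      congr 1; ring
    have e1 : Real.exp (-((1 + β ^ 2) / (2 * β ^ 2)) * ‖t‖ ^ 2) =
        Real.exp (-‖t‖ ^ 2 / 2) * Real.exp (- ‖t‖ ^ 2 / (2 * β ^ 2)) := by
      rw [← Real.exp_add]; congr 1; field_simp; ring
    have e2 : Real.exp (-((1 + 2 * β ^ 2) / (2 * β ^ 2)) * ‖t‖ ^ 2) =
        Real.exp (-‖t‖ ^ 2 / 2) ^ 2 * Real.exp (- ‖t‖ ^ 2 / (2 * β ^ 2)) := by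
      rw [← Real.exp_nat_mul, ← Real.exp_add]; congr 1; field_simp; ring
    rw [hr, hn, norm_sq_mul_sum_cexp_sub]
    simp only [g, e0, e1, e2, ← Finset.mul_sum, inner_sub_right, inner_zero_right, Real.cos_zero]
    ring
  have i0 : Integrable (fun t ↦ ∑ j, ∑ k, g 1 (Y j - Y k) t) :=
    integrable_finsetSum _ fun j _ ↦ integrable_finsetSum _ fun k _ ↦ hint h0 _
  have i1 : Integrable (fun t ↦ ∑ j, g (1 + β ^ 2) (Y j) t) :=
    integrable_finsetSum _ fun j _ ↦ hint h1 _
  have v0 : ∫ t, ∑ j, ∑ k, g 1 (Y j - Y k) t =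
      ∑ j, ∑ k, Real.exp (- (β ^ 2 / 2) * ‖Y j - Y k‖ ^ 2) := by
    rw [integral_finsetSum _ fun j _ ↦ integrable_finsetSum _ fun k _ ↦ hint h0 _]
    refine Finset.sum_congr rfl fun j _ ↦ ?_
    rw [integral_finsetSum _ fun k _ ↦ hint h0 _]
    refine Finset.sum_congr rfl fun k _ ↦ ?_
    rw [hval h0, Real.one_rpow, one_mul]
    congr 1; ring
  have v1 : ∫ t, ∑ j, g (1 + β ^ 2) (Y j) t = (1 + β ^ 2) ^ (-(d : ℝ) / 2) *
      ∑ j, Real.exp (- β ^ 2 * ‖Y j‖ ^ 2 / (2 * (1 + β ^ 2))) := by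
    rw [integral_finsetSum _ fun j _ ↦ hint h1 _, Finset.mul_sum]
    exact Finset.sum_congr rfl fun j _ ↦ hval h1 _
  have v2 : ∫ t, g (1 + 2 * β ^ 2) 0 t = (1 + 2 * β ^ 2) ^ (-(d : ℝ) / 2) := by
    rw [hval h2]; simp
  simp_rw [hpt]
  have i2 : Integrable (g (1 + 2 * β ^ 2) 0) := hint h2 0
  have i01 : Integrable (fun t ↦ ((n : ℝ) ^ 2)⁻¹ * ∑ j, ∑ k, g 1 (Y j - Y k) t
      - 2 * (n : ℝ)⁻¹ * ∑ j, g (1 + β ^ 2) (Y j) t) := (i0.const_mul _).sub (i1.const_mul _)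
  rw [integral_add i01 i2,
    integral_sub (i0.const_mul _) (i1.const_mul _), integral_const_mul, integral_const_mul,
    v0, v1, v2]
  ring

end
end
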